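/- Let n be a positive integer, let q_1, …, q_{n+1} be positive integers with 2q_j dividing q_{j+1} for j = 1, …, n, and let p be an integer coprime to q_{n+1}. Define N_n(x) = #{k ∈ {1, …, q_{n+1}} : m_n(x + k·p/q_{n+1}) = m_n(x)} for x ∈ 𝕋. Then ∫_𝕋 N_n² dλ = (q_{n+1}²/2^{3n})·Σ_{i=0}^{n} C(n, i)³. -/

import Mathlib

open MeasureTheory

/-- The Haar function `T : 𝕋 → ℤ`, equal to `1` on `[0,1/2)` and `-1` on `[1/2,1)`. -/
noncomputable def haarT (x : UnitAddCircle) : ℤ :=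
  if (AddCircle.equivIco 1 0 x : ℝ) < 1/2 then 1 else -1

/-- `m_n(x) = T(q_1 x) + ⋯ + T(q_n x)` (here `q j`, `j < n`, stands for the paper's `q_{j+1}`). -/
noncomputable def mSum (q : ℕ → ℕ) (n : ℕ) (x : UnitAddCircle) : ℤ :=
  ∑ j ∈ Finset.range n, haarT (q j • x)

/-- The counting function
`N_n(x) = #{k ∈ {1, …, q_{n+1}} : m_n(x + k·p/q_{n+1}) = m_n(x)}`
(here `q n` is the paper's `q_{n+1}`). -/
noncomputable def countN (q : ℕ → ℕ) (n : ℕ) (p : ℤ) (x : UnitAddCircle) : ℕ :=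
  {k : ℕ | k ∈ Finset.Icc 1 (q n) ∧
    mSum q n (x + (((k : ℝ) * (p : ℝ) / (q n : ℝ) : ℝ) : UnitAddCircle)) = mSum q n x}.ncard

lemma haarT_coe (t : ℝ) : haarT (t : UnitAddCircle) = if Int.fract t < 1 / 2 then 1 else -1 := by
  have h := AddCircle.coe_equivIco_mk_apply (p := (1 : ℝ)) t
  rw [haarT]
  erw [h]
  simp

lemma haarT_eq_or (x : UnitAddCircle) : haarT x = 1 ∨ haarT x = -1 := by
  rw [haarT]
  split_ifs <;> simp

lemma haarT_add_half (x : UnitAddCircle) :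
    haarT (x + ((1 / 2 : ℝ) : UnitAddCircle)) = -haarT x := by
  induction x using QuotientAddGroup.induction_on with
  | H t =>
    change haarT ((t : UnitAddCircle) + ((1 / 2 : ℝ) : UnitAddCircle)) = -haarT (t : UnitAddCircle)
    rw [← AddCircle.coe_add, haarT_coe, haarT_coe]
    have h0 := Int.fract_nonneg t
    have h1 := Int.fract_lt_one t
    have ht := Int.floor_add_fract t
    by_cases h : Int.fract t < 1 / 2
    · have : Int.fract (t + 1 / 2) = Int.fract t + 1 / 2 :=
        Int.fract_eq_iff.2 ⟨by linarith, by linarith, ⌊t⌋, by linarith⟩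
      rw [this, if_pos h, if_neg (by linarith)]
    · have : Int.fract (t + 1 / 2) = Int.fract t - 1 / 2 :=
        Int.fract_eq_iff.2 ⟨by linarith, by linarith, ⌊t⌋ + 1, by push_cast; linarith⟩
      rw [this, if_neg h, if_pos (by linarith)]
      simp

lemma measurable_haarT : Measurable haarT := by
  unfold haarT
  refine Measurable.ite ?_ measurable_const measurable_const
  exact measurableSet_lt
    (measurable_subtype_coe.comp (AddCircle.measurableEquivIco 1 0).measurable) measurable_const

lemma measurable_mSum (q : ℕ → ℕ) (n : ℕ) : Measurable (mSum q n) := by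
  unfold mSum
  exact Finset.measurable_sum _ fun j _ =>
    measurable_haarT.comp (continuous_nsmul (q j)).measurable

lemma abs_mSum_le (q : ℕ → ℕ) (n : ℕ) (x : UnitAddCircle) : |mSum q n x| ≤ n := by
  refine (Finset.abs_sum_le_sum_abs _ _).trans ?_
  refine (Finset.sum_le_sum (g := fun _ => (1 : ℤ)) fun j _ => ?_).trans (by simp)
  rcases haarT_eq_or (q j • x) with h | h <;> simp [h]

lemma integrable_comp_mSum (q : ℕ → ℕ) (n : ℕ) (F : ℤ → ℝ) :
    Integrable (fun x => F (mSum q n x)) (volume : Measure UnitAddCircle) := by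
  refine Integrable.of_bound
    ((measurable_of_countable F).comp (measurable_mSum q n)).aestronglyMeasurable
    (∑ i ∈ Finset.Icc (-n : ℤ) n, ‖F i‖) (Filter.Eventually.of_forall fun x => ?_)
  exact Finset.single_le_sum (f := fun i => ‖F i‖) (fun i _ => norm_nonneg _)
    (Finset.mem_Icc.2 (abs_le.1 (abs_mSum_le q n x)))

lemma sum_range_mul_eq_sum_sum {M : Type*} [AddCommMonoid M] (f : ℕ → M) (m n : ℕ) :
    ∑ k ∈ Finset.range (m * n), f k
      = ∑ b ∈ Finset.range m, ∑ a ∈ Finset.range n, f (n * b + a) := by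
  induction m with
  | zero => simp
  | succ m ih => rw [Nat.succ_mul, Finset.sum_range_add, ih, Finset.sum_range_succ, mul_comm m n]

/-- Averaging a function of `haarT` over the translates by multiples of `1 / (2r)`. -/
lemma sum_haarT_translates (H : ℤ → ℝ) (r : ℕ) (hr : 0 < r) (z : UnitAddCircle) :
    ∑ a ∈ Finset.range (2 * r), H (haarT (z + ((a / (2 * r : ℝ) : ℝ) : UnitAddCircle)))
      = r * (H 1 + H (-1)) := by
  rw [two_mul r, Finset.sum_range_add, ← Finset.sum_add_distrib]
  have hr' : (r : ℝ) ≠ 0 := by positivity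
  rw [Finset.sum_congr rfl (g := fun _ => H 1 + H (-1)), Finset.sum_const, Finset.card_range,
    nsmul_eq_mul]
  intro a _
  have e : (((r + a : ℕ) : ℝ) / (2 * r)) = a / (2 * r) + 1 / 2 := by
    push_cast; field_simp; ring
  rw [e, AddCircle.coe_add, ← add_assoc, haarT_add_half]
  rcases haarT_eq_or (z + ((a / (2 * r : ℝ) : ℝ) : UnitAddCircle)) with h | h <;> rw [h]
  rw [neg_neg, add_comm]

/-- Along the translates by multiples of `1 / q n`, the sum `mSum q n` is binomially distributed. -/
lemma sum_mSum_translates (q : ℕ → ℕ) (n : ℕ) (hq : ∀ j ≤ n, 0 < q j)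
    (hdvd : ∀ j < n, 2 * q j ∣ q (j + 1)) (F : ℤ → ℝ) (x : UnitAddCircle) :
    ∑ k ∈ Finset.range (q n), F (mSum q n (x + ((k / q n : ℝ) : UnitAddCircle)))
      = q n / 2 ^ n * ∑ i ∈ Finset.range (n + 1), (n.choose i : ℝ) * F (n - 2 * i) := by
  induction n generalizing F x with
  | zero => simp [mSum]
  | succ n ih =>
    specialize ih (fun j hj => hq j (by omega)) (fun j hj => hdvd j (by omega))
    obtain ⟨r, hr⟩ := hdvd n (by omega)
    have hQ := hq (n + 1) le_rfl
    have hn := hq n (by omega)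
    have hr0 : 0 < r := Nat.pos_of_ne_zero (by rintro rfl; omega)
    have hr' : (r : ℝ) ≠ 0 := by positivity
    have hn' : (q n : ℝ) ≠ 0 := by positivity
    have hr2 : q (n + 1) = q n * (2 * r) := by rw [hr]; ring
    have key : ∀ a b : ℕ,
        F (mSum q (n + 1) (x + ((((2 * r * b + a : ℕ) : ℝ) / q (n + 1) : ℝ) : UnitAddCircle)))
        = F (mSum q n ((x + ((a / q (n + 1) : ℝ) : UnitAddCircle))
              + ((b / q n : ℝ) : UnitAddCircle))
            + haarT (q n • x + ((a / (2 * r) : ℝ) : UnitAddCircle))) := by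
      intro a b
      have e : (((2 * r * b + a : ℕ) : ℝ) / q (n + 1) : ℝ) = a / q (n + 1) + b / q n := by
        rw [hr2]; push_cast; field_simp; ring
      have e1 : q n • ((b / q n : ℝ) : UnitAddCircle) = 0 := by
        rw [← AddCircle.coe_nsmul, nsmul_eq_mul, mul_div_cancel₀ _ hn']
        have := AddCircle.coe_nsmul (p := (1 : ℝ)) (n := b) (x := 1)
        rw [AddCircle.coe_period, smul_zero] at this
        simpa using this
      have e2 : q n • ((a / q (n + 1) : ℝ) : UnitAddCircle)
          = ((a / (2 * r) : ℝ) : UnitAddCircle) := by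
        rw [← AddCircle.coe_nsmul, nsmul_eq_mul, hr2]
        congr 1
        push_cast; field_simp
      rw [mSum, Finset.sum_range_succ, ← mSum, e, AddCircle.coe_add, ← add_assoc,
        smul_add (q n), e1, add_zero, smul_add, e2]
    conv_lhs => rw [hr2, sum_range_mul_eq_sum_sum]
    rw [← hr2, Finset.sum_comm]
    simp_rw [key]
    rw [Finset.sum_congr rfl fun (a : ℕ) _ => ih
      (fun s => F (s + haarT (q n • x + ((a / (2 * r) : ℝ) : UnitAddCircle)))) _]
    rw [sum_haarT_translates (fun t => (q n : ℝ) / 2 ^ n * ∑ i ∈ Finset.range (n + 1),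
      (n.choose i : ℝ) * F (n - 2 * i + t)) r hr0]
    have hc := Finset.sum_choose_succ_mul (fun i _ => F ((n + 1 : ℕ) - 2 * i)) n
    rw [hc, hr2]
    have h1 : ∀ i : ℕ, ((n + 1 : ℕ) : ℤ) - 2 * i = n - 2 * i + 1 := by intro i; push_cast; ring
    have h2 : ∀ i : ℕ, ((n + 1 : ℕ) : ℤ) - 2 * ((i + 1 : ℕ) : ℤ) = n - 2 * i + -1 := by
      intro i; push_cast; ring
    simp_rw [h2, h1]
    push_cast
    field_simp
    ring

lemma sum_range_eq_sum_zmod (Q : ℕ) [NeZero Q] (g : ZMod Q → ℝ) :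
    ∑ k ∈ Finset.range Q, g k = ∑ z, g z := by
  refine Finset.sum_nbij' (fun k => (k : ZMod Q)) ZMod.val (by simp)
    (fun z _ => Finset.mem_range.2 (ZMod.val_lt z)) ?_ (by simp) (by simp)
  intro k hk
  exact ZMod.val_cast_of_lt (Finset.mem_range.1 hk)

/-- The multiples of `p / Q`, with `p` coprime to `Q`, run through all the multiples of `1 / Q`. -/
lemma sum_Icc_mul_div_eq_sum_range (Q : ℕ) (hQ : 0 < Q) (p : ℤ) (hp : IsCoprime p (Q : ℤ))
    (f : UnitAddCircle → ℝ) :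
    ∑ k ∈ Finset.Icc 1 Q, f (((k : ℝ) * (p : ℝ) / (Q : ℝ) : ℝ) : UnitAddCircle)
      = ∑ k ∈ Finset.range Q, f ((k / Q : ℝ) : UnitAddCircle) := by
  have : NeZero Q := ⟨hQ.ne'⟩
  set u := ZMod.unitOfIsCoprime p hp with hu
  have hl : ∀ k : ℕ, f (((k : ℝ) * (p : ℝ) / (Q : ℝ) : ℝ) : UnitAddCircle)
      = f (ZMod.toAddCircle ((u : ZMod Q) * (k : ZMod Q))) := by
    intro k
    rw [hu, ZMod.coe_unitOfIsCoprime]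
    have := ZMod.toAddCircle_intCast (N := Q) (p * k)
    push_cast at this
    rw [this, mul_comm (k : ℝ)]
  have hs : ∀ g : ℕ → ℝ, g Q = g 0 → ∑ k ∈ Finset.Icc 1 Q, g k = ∑ k ∈ Finset.range Q, g k := by
    intro g hg
    have h1 := Finset.sum_range_succ g Q
    have h2 := Finset.sum_range_succ' g Q
    rw [← Finset.Ico_add_one_right_eq_Icc, Finset.sum_Ico_eq_sum_range]
    simp only [Nat.add_sub_cancel, add_comm 1]
    linarith
  simp_rw [hl]
  rw [hs _ (by simp), sum_range_eq_sum_zmod Q fun z => f (ZMod.toAddCircle ((u : ZMod Q) * z))]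
  simp_rw [← ZMod.toAddCircle_natCast]
  rw [sum_range_eq_sum_zmod Q fun z => f (ZMod.toAddCircle z)]
  exact Equiv.sum_comp (Units.mulLeft u) fun z => f (ZMod.toAddCircle z)

lemma countN_eq (n : ℕ) (q : ℕ → ℕ) (hq : ∀ j ≤ n, 0 < q j)
    (hdvd : ∀ j < n, 2 * q j ∣ q (j + 1)) (p : ℤ) (hp : IsCoprime p (q n : ℤ))
    (x : UnitAddCircle) :
    (countN q n p x : ℝ) = q n / 2 ^ n * ∑ i ∈ Finset.range (n + 1),
      (n.choose i : ℝ) * if (n - 2 * i : ℤ) = mSum q n x then 1 else 0 := by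
  rw [← sum_mSum_translates q n hq hdvd (fun s => if s = mSum q n x then 1 else 0) x,
    ← sum_Icc_mul_div_eq_sum_range (q n) (hq n le_rfl) p hp
      (fun y => if mSum q n (x + y) = mSum q n x then 1 else 0), Finset.sum_boole, countN,
    ← Set.ncard_coe_finset]
  simp only [Finset.coe_filter]

lemma integral_comp_mSum (n : ℕ) (q : ℕ → ℕ) (hq : ∀ j ≤ n, 0 < q j)
    (hdvd : ∀ j < n, 2 * q j ∣ q (j + 1)) (F : ℤ → ℝ) :
    ∫ x, F (mSum q n x) ∂(volume : Measure UnitAddCircle)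
      = 1 / 2 ^ n * ∑ i ∈ Finset.range (n + 1), (n.choose i : ℝ) * F (n - 2 * i) := by
  have hQ : (q n : ℝ) ≠ 0 := by
    have := hq n le_rfl
    positivity
  have h : (q n : ℝ) * ∫ x, F (mSum q n x) ∂(volume : Measure UnitAddCircle)
      = q n / 2 ^ n * ∑ i ∈ Finset.range (n + 1), (n.choose i : ℝ) * F (n - 2 * i) := by
    calc (q n : ℝ) * ∫ x, F (mSum q n x) ∂(volume : Measure UnitAddCircle)
        = ∑ k ∈ Finset.range (q n), ∫ x, F (mSum q n (x + ((k / q n : ℝ) : UnitAddCircle)))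
            ∂(volume : Measure UnitAddCircle) := by
          simp_rw [fun y : UnitAddCircle =>
            integral_add_right_eq_self (μ := (volume : Measure UnitAddCircle))
              (fun x => F (mSum q n x)) y]
          simp
      _ = _ := by
          rw [← integral_finsetSum _ fun k _ => (integrable_comp_mSum q n F).comp_add_right _]
          simp_rw [sum_mSum_translates q n hq hdvd F]
          rw [integral_const, measureReal_def, UnitAddCircle.measure_univ, ENNReal.toReal_one,
            one_smul]
  rw [← mul_right_inj' hQ, h]
  ring

/-- for positive integers `q_1, …, q_{n+1}` (here `q j` is the paper's
`q_{j+1}`) with `2q_j ∣ q_{j+1}` and `p` coprime to `q_{n+1}`,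
`∫_𝕋 N_n² dλ = (q_{n+1}²/2^{3n})·Σ_{i=0}^{n} C(n, i)³`. -/
theorem statement18 (n : ℕ) (hn : 0 < n) (q : ℕ → ℕ) (hq : ∀ j ≤ n, 0 < q j)
    (hdvd : ∀ j < n, 2 * q j ∣ q (j + 1))
    (p : ℤ) (hp : IsCoprime p (q n : ℤ)) :
    (∫ x, (countN q n p x : ℝ) ^ 2 ∂(volume : Measure UnitAddCircle))
      = (q n : ℝ) ^ 2 / 2 ^ (3 * n) *
          ∑ i ∈ Finset.range (n + 1), (Nat.choose n i : ℝ) ^ 3 := by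
  have h : ∀ x, (countN q n p x : ℝ) ^ 2 = (fun s : ℤ => ((q n : ℝ) / 2 ^ n *
      ∑ i ∈ Finset.range (n + 1), (n.choose i : ℝ) * if (n - 2 * i : ℤ) = s then 1 else 0) ^ 2)
        (mSum q n x) := fun x => by rw [countN_eq n q hq hdvd p hp x]
  rw [integral_congr_ae (Filter.Eventually.of_forall h), integral_comp_mSum n q hq hdvd
    (fun s : ℤ => ((q n : ℝ) / 2 ^ n *
      ∑ i ∈ Finset.range (n + 1), (n.choose i : ℝ) * if (n - 2 * i : ℤ) = s then 1 else 0) ^ 2),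
    Finset.mul_sum, Finset.mul_sum]
  refine Finset.sum_congr rfl fun i hi => ?_
  have hs : ∑ j ∈ Finset.range (n + 1), (n.choose j : ℝ) *
      (if (n - 2 * j : ℤ) = n - 2 * i then 1 else 0) = n.choose i := by
    rw [Finset.sum_eq_single_of_mem i hi]
    · simp
    · intro j _ hj
      rw [if_neg (by omega), mul_zero]
  rw [hs, pow_mul']
  field_simp
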